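/- arXiv:2502.11622 — 2 statements merged into one kernel-verified Lean document; each statement's English description precedes it below -/
import Mathlib

section
/- Let Γ be a countable discrete group and ρ an amenable IRE on Γ. Then there exists a sequence of finite IREs on Γ converging weakly to ρ (in the weak topology on Borel probability measures on E). -/
open MeasureTheory Filter Topology

/-- A function `r : Γ × Γ → Bool` codes an equivalence relation on `Γ`. -/
def IsEqRel {Γ : Type*} (r : Γ × Γ → Bool) : Prop :=
  (∀ x, r (x, x) = true) ∧ (∀ x y, r (x, y) = true → r (y, x) = true) ∧
    (∀ x y z, r (x, y) = true → r (y, z) = true → r (x, z) = true)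

/-- The space `E` of equivalence relations on `Γ`, as a subspace of `{0,1}^{Γ×Γ}`. -/
abbrev EqRelSpace (Γ : Type*) : Type _ := ↥{r : Γ × Γ → Bool | IsEqRel r}

variable {Γ : Type*} [Group Γ]

/-- The left shift action of `Γ` on the space of equivalence relations:
`(γ·r)(x,y) = r(γ⁻¹x, γ⁻¹y)`. -/
def shiftE (γ : Γ) (r : EqRelSpace Γ) : EqRelSpace Γ :=
  ⟨fun p => r.1 (γ⁻¹ * p.1, γ⁻¹ * p.2),
    ⟨fun _ => r.2.1 _, fun _ _ h => r.2.2.1 _ _ h, fun _ _ _ h h' => r.2.2.2 _ _ _ h h'⟩⟩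

/-- The `r`-class of `g ∈ Γ`. -/
def classOf (r : EqRelSpace Γ) (g : Γ) : Set Γ := {h | r.1 (g, h) = true}

/-- An invariant random equivalence relation: a Borel probability measure on `E`
invariant under the left shift action. -/
def IsIRE (ρ : ProbabilityMeasure (EqRelSpace Γ)) : Prop :=
  ∀ γ : Γ, ρ.toMeasure.map (shiftE γ) = ρ.toMeasure

/-- A finite IRE: almost every equivalence relation has all classes finite. -/
def IsFIRE (ρ : ProbabilityMeasure (EqRelSpace Γ)) : Prop :=
  IsIRE ρ ∧ ∀ᵐ r ∂ρ.toMeasure, ∀ g : Γ, (classOf r g).Finite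

/-- An amenable IRE: there are Borel maps `λ_n : E → Prob(Γ)` (coded coordinatewise as
`lam : ℕ → E → Γ → ℝ`) such that for a.e. `r` and every `g` in the class of the identity,
`‖g⁻¹·λ_n^r − λ_n^{g⁻¹·r}‖₁ → 0`; here `(g⁻¹·λ_n^r)(h) = λ_n^r(gh)`. -/
def IsAIRE (ρ : ProbabilityMeasure (EqRelSpace Γ)) : Prop :=
  IsIRE ρ ∧ ∃ lam : ℕ → EqRelSpace Γ → Γ → ℝ,
    (∀ n g, Measurable fun r => lam n r g) ∧
    (∀ n r g, 0 ≤ lam n r g) ∧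
    (∀ n r, ∑' g, lam n r g = 1) ∧
    ∀ᵐ r ∂ρ.toMeasure, ∀ g ∈ classOf r 1,
      Tendsto (fun n => ∑' h : Γ, |lam n r (g * h) - lam n (shiftE g⁻¹ r) h|) atTop (𝓝 0)

/-- Topological amenability of an action `a : Γ → X → X` on a topological space:
there are continuous maps `η_n : X → Prob(Γ)` (coded coordinatewise) with
`sup_x ‖γ·η_n^x − η_n^{γ·x}‖₁ → 0` for every `γ`; here `(γ·η)(g) = η(γ⁻¹g)`. -/
def TopAmenableAction (Γ : Type*) [Group Γ] {X : Type*} [TopologicalSpace X]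
    (a : Γ → X → X) : Prop :=
  ∃ η : ℕ → X → Γ → ℝ,
    (∀ n x g, 0 ≤ η n x g) ∧
    (∀ n x, ∑' g, η n x g = 1) ∧
    (∀ n g, Continuous fun x => η n x g) ∧
    ∀ γ : Γ, ∀ ε > (0 : ℝ), ∃ N, ∀ n ≥ N, ∀ x : X,
      ∑' g : Γ, |η n x (γ⁻¹ * g) - η n (a γ x) g| < ε

/-- A countable group is exact iff it admits a topologically amenable continuous action
on a nonempty compact metrizable space. -/
def IsExactGroup (Γ : Type*) [Group Γ] : Prop :=
  ∃ (X : Type) (_ : TopologicalSpace X) (a : Γ → X → X),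
    Nonempty X ∧ CompactSpace X ∧ TopologicalSpace.MetrizableSpace X ∧
    (∀ x, a 1 x = x) ∧ (∀ γ δ x, a (γ * δ) x = a γ (a δ x)) ∧
    (∀ γ, Continuous (a γ)) ∧ TopAmenableAction Γ a

open scoped ENNReal

section Labels

/-- The uniform distribution on `[0, 1]`, as a measure on `ℝ`. -/
noncomputable def uniformLaw : Measure ℝ := volume.restrict (Set.Icc 0 1)

instance : IsProbabilityMeasure uniformLaw := ⟨by simp [uniformLaw]⟩

/-- The law of a family of independent uniform labels. -/
noncomputable def labelLaw (ι : Type*) : Measure (ι → ℝ) :=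
  Measure.infinitePi fun _ => uniformLaw

instance (ι : Type*) : IsProbabilityMeasure (labelLaw ι) := by
  unfold labelLaw; infer_instance

theorem uniformLaw_Iio_le (a : ℝ) : uniformLaw (Set.Iio a) ≤ ENNReal.ofReal a := by
  rw [uniformLaw, Measure.restrict_apply measurableSet_Iio]
  calc volume (Set.Iio a ∩ Set.Icc 0 1) ≤ volume (Set.Ico 0 a) :=
        measure_mono fun x hx => ⟨hx.2.1, hx.1⟩
    _ = ENNReal.ofReal a := by simp

theorem uniformLaw_Ici_le (a : ℝ) :
    uniformLaw (Set.Ici a) ≤ ENNReal.ofReal (Real.exp (-a)) := by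
  rw [uniformLaw, Measure.restrict_apply measurableSet_Ici]
  calc volume (Set.Ici a ∩ Set.Icc 0 1) ≤ volume (Set.Icc a 1) :=
        measure_mono fun x hx => ⟨hx.1, hx.2.2⟩
    _ = ENNReal.ofReal (1 - a) := by simp
    _ ≤ _ := ENNReal.ofReal_le_ofReal (by linarith [Real.add_one_le_exp (-a)])

theorem uniformLaw_separating_le (a b : ℝ) :
    uniformLaw {u | ¬(u < a ↔ u < b)} ≤ ENNReal.ofReal |a - b| := by
  calc uniformLaw {u | ¬(u < a ↔ u < b)} ≤ volume {u | ¬(u < a ↔ u < b)} :=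
        Measure.restrict_le_self _
    _ ≤ volume (Set.Ico (min a b) (max a b)) := measure_mono fun u hu => by
        simp only [Set.mem_ofPred_eq] at hu
        simp only [Set.mem_Ico, min_le_iff, lt_max_iff]
        grind
    _ = ENNReal.ofReal |a - b| := by
        rw [Real.volume_Ico, max_sub_min_eq_abs, abs_sub_comm]

theorem labelLaw_eval {ι : Type*} (i : ι) {s : Set ℝ} (hs : MeasurableSet s) :
    labelLaw ι {u | u i ∈ s} = uniformLaw s :=
  (measurePreserving_eval_infinitePi (fun _ : ι => uniformLaw) i).measure_preimage
    hs.nullMeasurableSet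

/-- The set of indices whose label lies below the threshold `p`. -/
def marked {ι : Type*} (p u : ι → ℝ) : Set ι := {i | u i < p i}

theorem labelLaw_marked_ne_le {ι : Type*} [Countable ι] (p q : ι → ℝ) :
    labelLaw ι {u | marked p u ≠ marked q u} ≤ ∑' i, ENNReal.ofReal |p i - q i| := by
  calc labelLaw ι {u | marked p u ≠ marked q u}
      ≤ labelLaw ι (⋃ i, {u | u i ∈ {t | ¬(t < p i ↔ t < q i)}}) :=
        measure_mono fun u hu => by
          simpa [marked, Set.ext_iff] using hu
    _ ≤ ∑' i, labelLaw ι {u | u i ∈ {t | ¬(t < p i ↔ t < q i)}} := measure_iUnion_le _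
    _ ≤ ∑' i, ENNReal.ofReal |p i - q i| := ENNReal.tsum_le_tsum fun i => by
        rw [labelLaw_eval i (by measurability)]
        exact uniformLaw_separating_le _ _

theorem labelLaw_marked_empty_le {ι : Type*} {p : ι → ℝ} {c : ℝ}
    (hc : HasSum p c) :
    labelLaw ι {u | marked p u = ∅} ≤ ENNReal.ofReal (Real.exp (-c)) := by
  have hlim : Tendsto (fun s : Finset ι => ENNReal.ofReal (Real.exp (-∑ i ∈ s, p i))) atTop
      (𝓝 (ENNReal.ofReal (Real.exp (-c)))) :=
    ENNReal.tendsto_ofReal ((Real.continuous_exp.tendsto _).comp (Tendsto.neg hc))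
  refine ge_of_tendsto' hlim fun s => ?_
  calc labelLaw ι {u | marked p u = ∅}
      ≤ labelLaw ι (Set.pi s fun i => Set.Ici (p i)) := measure_mono fun u hu i _ => by
        have : ¬ u i < p i := (Set.eq_empty_iff_forall_notMem.1 hu i)
        exact not_lt.1 this
    _ = ∏ i ∈ s, uniformLaw (Set.Ici (p i)) :=
        Measure.infinitePi_pi _ fun _ _ => measurableSet_Ici
    _ ≤ ∏ i ∈ s, ENNReal.ofReal (Real.exp (-p i)) :=
        Finset.prod_le_prod' fun i _ => uniformLaw_Ici_le (p i)
    _ = ENNReal.ofReal (Real.exp (-∑ i ∈ s, p i)) := by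
        rw [← ENNReal.ofReal_prod_of_nonneg fun _ _ => (Real.exp_pos _).le, ← Real.exp_sum,
          Finset.sum_neg_distrib]

theorem measurePreserving_labelLaw_reindex {ι : Type*} (e : ι ≃ ι) :
    MeasurePreserving (fun (u : ι → ℝ) i => u (e i)) (labelLaw ι) (labelLaw ι) := by
  refine ⟨by fun_prop, ?_⟩
  have h := Measure.infinitePi_map_piCongrLeft (fun _ : ι => uniformLaw) e.symm
  refine Eq.trans (congrArg (fun f => Measure.map f (labelLaw ι)) ?_) h
  ext u i
  obtain ⟨j, rfl⟩ := e.symm.surjective i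
  simp [MeasurableEquiv.coe_piCongrLeft, Equiv.piCongrLeft_apply_apply]

end Labels

theorem measurable_shiftE (γ : Γ) : Measurable (shiftE γ) :=
  Measurable.subtype_mk <| measurable_pi_lambda _ fun p =>
    (measurable_pi_apply (γ⁻¹ * p.1, γ⁻¹ * p.2)).comp measurable_subtype_coe

theorem shiftE_shiftE (γ δ : Γ) (r : EqRelSpace Γ) :
    shiftE γ (shiftE δ r) = shiftE (γ * δ) r := by
  ext p
  simp [shiftE, mul_assoc]

theorem IsIRE.measurePreserving {ρ : ProbabilityMeasure (EqRelSpace Γ)} (hρ : IsIRE ρ) (γ : Γ) :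
    MeasurePreserving (shiftE γ) ρ.toMeasure ρ.toMeasure :=
  ⟨measurable_shiftE γ, hρ γ⟩

/-- The translate `x · l^{x⁻¹ r}` of a map `l` from equivalence relations to functions on `Γ`. -/
def translated (l : EqRelSpace Γ → Γ → ℝ) (r : EqRelSpace Γ) (x z : Γ) : ℝ :=
  l (shiftE x⁻¹ r) (x⁻¹ * z)

theorem translated_shiftE (l : EqRelSpace Γ → Γ → ℝ) (γ : Γ) (r : EqRelSpace Γ) (x z : Γ) :
    translated l (shiftE γ r) x z = translated l r (γ⁻¹ * x) (γ⁻¹ * z) := by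
  simp [translated, shiftE_shiftE, mul_assoc]

theorem measurable_translated {l : EqRelSpace Γ → Γ → ℝ} (hl : ∀ g, Measurable fun r => l r g)
    (x z : Γ) : Measurable fun r => translated l r x z :=
  (hl _).comp (measurable_shiftE _)

theorem hasSum_translated {l : EqRelSpace Γ → Γ → ℝ} {c : ℝ} (hl : ∀ r, HasSum (l r) c)
    (r : EqRelSpace Γ) (x : Γ) : HasSum (translated l r x) c :=
  (Equiv.mulLeft x⁻¹).hasSum_iff.2 (hl (shiftE x⁻¹ r))

open Classical in
/-- The subrelation of `r` in which two distinct points are related when they are `r`-related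
and mark the same nonempty set for the labels `u` and the thresholds `translated l r`. -/
noncomputable def cluster (l : EqRelSpace Γ → Γ → ℝ) (w : EqRelSpace Γ × (Γ → ℝ)) :
    EqRelSpace Γ :=
  ⟨fun p => decide (p.1 = p.2 ∨ w.1.1 p = true ∧
      marked (translated l w.1 p.1) w.2 = marked (translated l w.1 p.2) w.2 ∧
      (marked (translated l w.1 p.1) w.2).Nonempty), by
    refine ⟨by simp, fun x y h => ?_, fun x y z h h' => ?_⟩
    · simp only [decide_eq_true_eq] at h ⊢
      rcases h with rfl | ⟨h₁, h₂, h₃⟩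
      · exact .inl rfl
      · exact .inr ⟨w.1.2.2.1 _ _ h₁, h₂.symm, h₂ ▸ h₃⟩
    · simp only [decide_eq_true_eq] at h h' ⊢
      rcases h with rfl | ⟨h₁, h₂, h₃⟩
      · exact h'
      rcases h' with rfl | ⟨h₁', h₂', -⟩
      · exact .inr ⟨h₁, h₂, h₃⟩
      · exact .inr ⟨w.1.2.2.2 _ _ _ h₁ h₁', h₂.trans h₂', h₃⟩⟩

theorem cluster_apply_eq_true {l : EqRelSpace Γ → Γ → ℝ} {w : EqRelSpace Γ × (Γ → ℝ)}
    {p : Γ × Γ} : (cluster l w).1 p = true ↔ p.1 = p.2 ∨ w.1.1 p = true ∧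
      marked (translated l w.1 p.1) w.2 = marked (translated l w.1 p.2) w.2 ∧
      (marked (translated l w.1 p.1) w.2).Nonempty := by
  simp [cluster]

theorem measurableSet_mem_marked {l : EqRelSpace Γ → Γ → ℝ}
    (hl : ∀ g, Measurable fun r => l r g) (x z : Γ) :
    MeasurableSet {w : EqRelSpace Γ × (Γ → ℝ) | z ∈ marked (translated l w.1 x) w.2} :=
  measurableSet_lt ((measurable_pi_apply z).comp measurable_snd)
    ((measurable_translated hl x z).comp measurable_fst)

theorem measurableSet_rel {ι : Type*} (p : ι × ι) :
    MeasurableSet {r : EqRelSpace ι | r.1 p = true} :=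
  measurableSet_eq_fun ((measurable_pi_apply p).comp measurable_subtype_coe) measurable_const

theorem measurableSet_marked_eq [Countable Γ] {l : EqRelSpace Γ → Γ → ℝ}
    (hl : ∀ g, Measurable fun r => l r g) (x y : Γ) :
    MeasurableSet {w : EqRelSpace Γ × (Γ → ℝ) |
      marked (translated l w.1 x) w.2 = marked (translated l w.1 y) w.2} := by
  simp only [Set.ext_iff, Set.ofPred_forall]
  exact .iInter fun z => (measurableSet_mem_marked hl x z).iff (measurableSet_mem_marked hl y z)

theorem measurableSet_marked_nonempty [Countable Γ] {l : EqRelSpace Γ → Γ → ℝ}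
    (hl : ∀ g, Measurable fun r => l r g) (x : Γ) :
    MeasurableSet {w : EqRelSpace Γ × (Γ → ℝ) | (marked (translated l w.1 x) w.2).Nonempty} := by
  simp only [Set.Nonempty, Set.ofPred_exists]
  exact .iUnion fun z => measurableSet_mem_marked hl x z

theorem measurable_cluster [Countable Γ] {l : EqRelSpace Γ → Γ → ℝ}
    (hl : ∀ g, Measurable fun r => l r g) : Measurable (cluster l) := by
  refine Measurable.subtype_mk <| measurable_pi_lambda _ fun p => measurable_to_bool ?_
  have : (fun w => (cluster l w).1 p) ⁻¹' {true} = {w | p.1 = p.2 ∨ w.1.1 p = true ∧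
      marked (translated l w.1 p.1) w.2 = marked (translated l w.1 p.2) w.2 ∧
      (marked (translated l w.1 p.1) w.2).Nonempty} := by
    ext w
    exact cluster_apply_eq_true
  change MeasurableSet ((fun w => (cluster l w).1 p) ⁻¹' {true})
  rw [this]
  exact MeasurableSet.union (.const _) <| .inter (measurable_fst (measurableSet_rel p)) <|
    .inter (measurableSet_marked_eq hl _ _) (measurableSet_marked_nonempty hl _)

/-- The diagonal shift on pairs of an equivalence relation and a labelling. -/
def shiftLabelled (γ : Γ) (w : EqRelSpace Γ × (Γ → ℝ)) : EqRelSpace Γ × (Γ → ℝ) :=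
  (shiftE γ w.1, fun z => w.2 (γ⁻¹ * z))

theorem marked_shiftLabelled (l : EqRelSpace Γ → Γ → ℝ) (γ : Γ) (w : EqRelSpace Γ × (Γ → ℝ))
    (x : Γ) :
    marked (translated l (shiftLabelled γ w).1 x) (shiftLabelled γ w).2 =
      (γ⁻¹ * ·) ⁻¹' marked (translated l w.1 (γ⁻¹ * x)) w.2 := by
  ext z
  simp [marked, shiftLabelled, translated_shiftE]

theorem cluster_shiftLabelled (l : EqRelSpace Γ → Γ → ℝ) (γ : Γ)
    (w : EqRelSpace Γ × (Γ → ℝ)) :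
    cluster l (shiftLabelled γ w) = shiftE γ (cluster l w) := by
  have hs : Function.Surjective (γ⁻¹ * · : Γ → Γ) := mul_left_surjective _
  ext p
  rw [Bool.eq_iff_iff, cluster_apply_eq_true]
  change _ ↔ (cluster l w).1 (γ⁻¹ * p.1, γ⁻¹ * p.2) = true
  rw [cluster_apply_eq_true, marked_shiftLabelled, marked_shiftLabelled,
    hs.preimage_injective.eq_iff, hs.nonempty_preimage, mul_right_inj]
  rfl

theorem IsIRE.measurePreserving_shiftLabelled {ρ : ProbabilityMeasure (EqRelSpace Γ)}
    (hρ : IsIRE ρ) (γ : Γ) :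
    MeasurePreserving (shiftLabelled γ) (ρ.toMeasure.prod (labelLaw Γ))
      (ρ.toMeasure.prod (labelLaw Γ)) :=
  (hρ.measurePreserving γ).prod (measurePreserving_labelLaw_reindex (Equiv.mulLeft γ⁻¹))

/-- The law of the random subrelation `cluster l` of a random equivalence relation. -/
noncomputable def clusterLaw [Countable Γ] (ρ : ProbabilityMeasure (EqRelSpace Γ))
    {l : EqRelSpace Γ → Γ → ℝ} (hl : ∀ g, Measurable fun r => l r g) :
    ProbabilityMeasure (EqRelSpace Γ) :=
  ⟨(ρ.toMeasure.prod (labelLaw Γ)).map (cluster l),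
    Measure.isProbabilityMeasure_map (measurable_cluster hl).aemeasurable⟩

theorem isIRE_clusterLaw [Countable Γ] {ρ : ProbabilityMeasure (EqRelSpace Γ)} (hρ : IsIRE ρ)
    {l : EqRelSpace Γ → Γ → ℝ} (hl : ∀ g, Measurable fun r => l r g) :
    IsIRE (clusterLaw ρ hl) := by
  intro γ
  have hT := hρ.measurePreserving_shiftLabelled γ
  change ((ρ.toMeasure.prod (labelLaw Γ)).map (cluster l)).map (shiftE γ) =
    (ρ.toMeasure.prod (labelLaw Γ)).map (cluster l)
  rw [Measure.map_map (measurable_shiftE γ) (measurable_cluster hl)]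
  conv_rhs => rw [← hT.map_eq, Measure.map_map (measurable_cluster hl) hT.measurable]
  congr 1
  ext1 w
  exact (cluster_shiftLabelled l γ w).symm

/-- By mass transport, almost surely every point is marked by only finitely many others. -/
theorem ae_finite_mem_marked [Countable Γ] {ρ : ProbabilityMeasure (EqRelSpace Γ)}
    (hρ : IsIRE ρ) {l : EqRelSpace Γ → Γ → ℝ} (hl : ∀ g, Measurable fun r => l r g)
    (hl₀ : ∀ r g, 0 ≤ l r g) {c : ℝ} (hlc : ∀ r, HasSum (l r) c) (z : Γ) :
    ∀ᵐ w ∂ρ.toMeasure.prod (labelLaw Γ), {y | z ∈ marked (translated l w.1 y) w.2}.Finite := by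
  have hmass (y : Γ) : (ρ.toMeasure.prod (labelLaw Γ))
      {w | z ∈ marked (translated l w.1 y) w.2} ≤
        ∫⁻ r, ENNReal.ofReal (l r (y⁻¹ * z)) ∂ρ.toMeasure := by
    rw [Measure.prod_apply (measurableSet_mem_marked hl y z),
      ← (hρ.measurePreserving y⁻¹).lintegral_comp (hl _).ennreal_ofReal]
    refine lintegral_mono fun r => ?_
    exact (labelLaw_eval z measurableSet_Iio).trans_le (uniformLaw_Iio_le _)
  refine ae_finite_setOfPred_mem (s := fun y =>
    {w : EqRelSpace Γ × (Γ → ℝ) | z ∈ marked (translated l w.1 y) w.2}) ?_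
  refine ne_top_of_le_ne_top (ENNReal.ofReal_ne_top (r := c)) ?_
  calc ∑' y, (ρ.toMeasure.prod (labelLaw Γ)) {w | z ∈ marked (translated l w.1 y) w.2}
      ≤ ∑' y, ∫⁻ r, ENNReal.ofReal (l r (y⁻¹ * z)) ∂ρ.toMeasure := ENNReal.tsum_le_tsum hmass
    _ = ∫⁻ r, ∑' y, ENNReal.ofReal (l r (y⁻¹ * z)) ∂ρ.toMeasure :=
        (lintegral_tsum fun y => (hl _).ennreal_ofReal.aemeasurable).symm
    _ = ∫⁻ _, ENNReal.ofReal c ∂ρ.toMeasure := lintegral_congr fun r => by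
        refine (((Equiv.inv Γ).trans (Equiv.mulRight z)).tsum_eq
          fun g => ENNReal.ofReal (l r g)).trans ?_
        rw [← ENNReal.ofReal_tsum_of_nonneg (hl₀ r) (hlc r).summable, (hlc r).tsum_eq]
    _ = ENNReal.ofReal c := by simp

theorem finite_classOf_cluster {l : EqRelSpace Γ → Γ → ℝ} {w : EqRelSpace Γ × (Γ → ℝ)}
    (hw : ∀ z, {y | z ∈ marked (translated l w.1 y) w.2}.Finite) (g : Γ) :
    (classOf (cluster l w) g).Finite := by
  rcases (marked (translated l w.1 g) w.2).eq_empty_or_nonempty with h | ⟨z, hz⟩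
  · refine (Set.finite_singleton g).subset fun y hy => ?_
    rcases cluster_apply_eq_true.1 hy with hy | ⟨-, -, hy⟩
    · exact hy.symm
    · exact absurd h hy.ne_empty
  · refine (hw z).subset fun y hy => ?_
    rcases cluster_apply_eq_true.1 hy with hy | ⟨-, hy, -⟩
    · exact (show g = y from hy) ▸ hz
    · exact hy.subset hz

theorem measurableSet_finite_classOf {ι : Type*} [Countable ι] :
    MeasurableSet {r : EqRelSpace ι | ∀ g, (classOf r g).Finite} := by
  have (g : ι) : {r : EqRelSpace ι | (classOf r g).Finite} =
      ⋃ s : Finset ι, {r | ∀ h, h ∉ s → ¬ r.1 (g, h) = true} := by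
    ext r
    simp only [Set.mem_ofPred_eq, Set.mem_iUnion, not_imp_not]
    exact ⟨fun h => ⟨h.toFinset, fun y hy => h.mem_toFinset.2 hy⟩,
      fun ⟨s, hs⟩ => s.finite_toSet.subset hs⟩
  simp only [Set.ofPred_forall, this]
  exact .iInter fun g => .iUnion fun s => .iInter fun h => .iInter fun _ =>
    (measurableSet_rel (g, h)).compl

theorem isFIRE_clusterLaw [Countable Γ] {ρ : ProbabilityMeasure (EqRelSpace Γ)} (hρ : IsIRE ρ)
    {l : EqRelSpace Γ → Γ → ℝ} (hl : ∀ g, Measurable fun r => l r g)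
    (hl₀ : ∀ r g, 0 ≤ l r g) {c : ℝ} (hlc : ∀ r, HasSum (l r) c) :
    IsFIRE (clusterLaw ρ hl) := by
  refine ⟨isIRE_clusterLaw hρ hl, ?_⟩
  refine (ae_map_iff (measurable_cluster hl).aemeasurable measurableSet_finite_classOf).2 ?_
  filter_upwards [ae_all_iff.2 (ae_finite_mem_marked hρ hl hl₀ hlc)] with w hw
  exact finite_classOf_cluster hw

/-- The `ℓ¹` distance between the translates at two related points, zero if they are not. -/
noncomputable def defect (l : EqRelSpace Γ → Γ → ℝ) (p : Γ × Γ) (r : EqRelSpace Γ) : ℝ≥0∞ :=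
  {r : EqRelSpace Γ | r.1 p = true}.indicator
    (fun r => ∑' z, ENNReal.ofReal |translated l r p.1 z - translated l r p.2 z|) r

theorem measurable_defect [Countable Γ] {l : EqRelSpace Γ → Γ → ℝ}
    (hl : ∀ g, Measurable fun r => l r g) (p : Γ × Γ) : Measurable (defect l p) :=
  Measurable.indicator (Measurable.tsum fun z => Measurable.ennreal_ofReal <|
    (_root_.measurable_norm.comp
      ((measurable_translated hl p.1 z).sub (measurable_translated hl p.2 z))))
    (measurableSet_rel p)

theorem defect_smul (l : EqRelSpace Γ → Γ → ℝ) {c : ℝ} (hc : 0 ≤ c) (p : Γ × Γ)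
    (r : EqRelSpace Γ) :
    defect (fun r g => c * l r g) p r = ENNReal.ofReal c * defect l p r := by
  by_cases h : r.1 p = true
  · simp [defect, h, translated, ← mul_sub, abs_mul, abs_of_nonneg hc, ENNReal.ofReal_mul hc,
      ENNReal.tsum_mul_left]
  · simp [defect, h]

theorem prod_cluster_ne_le [Countable Γ] {ρ : ProbabilityMeasure (EqRelSpace Γ)}
    {l : EqRelSpace Γ → Γ → ℝ} (hl : ∀ g, Measurable fun r => l r g)
    {c : ℝ} (hlc : ∀ r, HasSum (l r) c) (p : Γ × Γ) :
    (ρ.toMeasure.prod (labelLaw Γ)) {w | (cluster l w).1 p ≠ w.1.1 p} ≤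
      ∫⁻ r, defect l p r ∂ρ.toMeasure + ENNReal.ofReal (Real.exp (-c)) := by
  have hmeas : MeasurableSet {w : EqRelSpace Γ × (Γ → ℝ) | (cluster l w).1 p ≠ w.1.1 p} :=
    (measurableSet_eq_fun
      ((measurable_pi_apply p).comp (measurable_subtype_coe.comp (measurable_cluster hl)))
      ((measurable_pi_apply p).comp (measurable_subtype_coe.comp measurable_fst))).compl
  rw [Measure.prod_apply hmeas]
  calc _ ≤ ∫⁻ r, (defect l p r + ENNReal.ofReal (Real.exp (-c))) ∂ρ.toMeasure :=
        lintegral_mono fun r => ?_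
    _ = _ := by rw [lintegral_add_right _ measurable_const]; simp
  by_cases h : r.1 p = true
  · calc labelLaw Γ {u | (cluster l (r, u)).1 p ≠ r.1 p}
        ≤ labelLaw Γ ({u | marked (translated l r p.1) u ≠ marked (translated l r p.2) u} ∪
            {u | marked (translated l r p.1) u = ∅}) := measure_mono fun u hu => by
          by_contra hcon
          simp only [Set.mem_union, Set.mem_ofPred_eq, not_or, not_not] at hcon
          refine hu ?_
          rw [h]
          exact cluster_apply_eq_true.2
            (.inr ⟨h, hcon.1, Set.nonempty_iff_ne_empty.2 hcon.2⟩)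
      _ ≤ _ := (measure_union_le _ _).trans <| add_le_add
          (by
            rw [defect, Set.indicator_of_mem (by exact h)]
            exact labelLaw_marked_ne_le _ _)
          (labelLaw_marked_empty_le (hasSum_translated hlc r p.1))
  · have : {u | (cluster l (r, u)).1 p ≠ r.1 p} = ∅ := by
      refine Set.eq_empty_iff_forall_notMem.2 fun u hu => hu ?_
      rw [Bool.eq_iff_iff, cluster_apply_eq_true]
      refine ⟨?_, fun h' => absurd h' h⟩
      rintro (h' | h')
      · exact (congrArg (fun y => r.1 (p.1, y) = true) h').mp (r.2.1 p.1)
      · exact h'.1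
    change labelLaw Γ {u | (cluster l (r, u)).1 p ≠ r.1 p} ≤ _
    simp [this]

theorem defect_le {l : EqRelSpace Γ → Γ → ℝ} (hl₀ : ∀ r g, 0 ≤ l r g) {c : ℝ}
    (hlc : ∀ r, HasSum (l r) c) (p : Γ × Γ) (r : EqRelSpace Γ) :
    defect l p r ≤ ENNReal.ofReal c + ENNReal.ofReal c := by
  have hmass (x : Γ) : ∑' z, ENNReal.ofReal (translated l r x z) = ENNReal.ofReal c := by
    have h₀ (z : Γ) : 0 ≤ translated l r x z := hl₀ _ _
    rw [← ENNReal.ofReal_tsum_of_nonneg h₀ (hasSum_translated hlc r x).summable,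
      (hasSum_translated hlc r x).tsum_eq]
  refine (Set.indicator_le_self _ _ r).trans ?_
  calc _ ≤ ∑' z, (ENNReal.ofReal (translated l r p.1 z) +
          ENNReal.ofReal (translated l r p.2 z)) := ENNReal.tsum_le_tsum fun z => by
        have h₁ : 0 ≤ translated l r p.1 z := hl₀ _ _
        have h₂ : 0 ≤ translated l r p.2 z := hl₀ _ _
        rw [← ENNReal.ofReal_add h₁ h₂]
        exact ENNReal.ofReal_le_ofReal (abs_sub_le_iff.2 ⟨by linarith, by linarith⟩)
    _ = _ := by rw [ENNReal.tsum_add, hmass, hmass]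

theorem tendsto_lintegral_defect [Countable Γ] {ρ : ProbabilityMeasure (EqRelSpace Γ)}
    (hρ : IsIRE ρ) {lam : ℕ → EqRelSpace Γ → Γ → ℝ}
    (hmeas : ∀ n g, Measurable fun r => lam n r g) (hnonneg : ∀ n r g, 0 ≤ lam n r g)
    (hsum : ∀ n r, HasSum (lam n r) 1)
    (hlim : ∀ᵐ r ∂ρ.toMeasure, ∀ g ∈ classOf r 1,
      Tendsto (fun n => ∑' h : Γ, |lam n r (g * h) - lam n (shiftE g⁻¹ r) h|) atTop (𝓝 0))
    (p : Γ × Γ) :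
    Tendsto (fun n => ∫⁻ r, defect (lam n) p r ∂ρ.toMeasure) atTop (𝓝 0) := by
  have hlim' := (hρ.measurePreserving p.1⁻¹).quasiMeasurePreserving.ae hlim
  rw [← lintegral_zero (μ := ρ.toMeasure)]
  refine tendsto_lintegral_of_dominated_convergence (fun _ => ENNReal.ofReal 1 + ENNReal.ofReal 1)
    (fun n => measurable_defect (hmeas n) p)
    (fun n => .of_forall fun r => defect_le (hnonneg n) (hsum n) p r) (by simp) ?_
  filter_upwards [hlim'] with r hr
  by_cases h : r.1 p = true
  · have hg : p.1⁻¹ * p.2 ∈ classOf (shiftE p.1⁻¹ r) 1 := by simpa [classOf, shiftE] using h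
    have key (n : ℕ) : defect (lam n) p r = ENNReal.ofReal
        (∑' h, |lam n (shiftE p.1⁻¹ r) (p.1⁻¹ * p.2 * h) -
          lam n (shiftE (p.1⁻¹ * p.2)⁻¹ (shiftE p.1⁻¹ r)) h|) := by
      rw [defect, Set.indicator_of_mem (by exact h), ← ENNReal.ofReal_tsum_of_nonneg
        (fun _ => abs_nonneg _) ((hasSum_translated (hsum n) r p.1).summable.sub
          (hasSum_translated (hsum n) r p.2).summable).abs, ← (Equiv.mulLeft p.2).tsum_eq]
      simp [translated, shiftE_shiftE, mul_assoc]
    simpa [key] using ENNReal.tendsto_ofReal (hr _ hg)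
  · simp [defect, h]

/-- Almost surely convergent random relations converge weakly in law. -/
theorem tendsto_clusterLaw [Countable Γ] {ρ : ProbabilityMeasure (EqRelSpace Γ)}
    {l : ℕ → EqRelSpace Γ → Γ → ℝ} (hl : ∀ n g, Measurable fun r => l n r g)
    (h : ∀ p, ∀ᵐ w ∂ρ.toMeasure.prod (labelLaw Γ), ∀ᶠ n in atTop,
      (cluster (l n) w).1 p = w.1.1 p) :
    Tendsto (fun n => clusterLaw ρ (hl n)) atTop (𝓝 ρ) := by
  rw [ProbabilityMeasure.tendsto_iff_forall_integral_tendsto]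
  intro f
  have hf : Measurable f := f.continuous.measurable
  have hmap (n : ℕ) : ∫ r, f r ∂(clusterLaw ρ (hl n)).toMeasure =
      ∫ w, f (cluster (l n) w) ∂ρ.toMeasure.prod (labelLaw Γ) :=
    integral_map (measurable_cluster (hl n)).aemeasurable hf.aestronglyMeasurable
  have hfst : ∫ r, f r ∂ρ.toMeasure = ∫ w, f w.1 ∂ρ.toMeasure.prod (labelLaw Γ) := by
    rw [integral_fun_fst (μ := ρ.toMeasure) (ν := labelLaw Γ) f]
    simp
  simp only [hmap, hfst]
  refine tendsto_integral_of_dominated_convergence (fun _ => ‖f‖)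
    (fun n => (hf.comp (measurable_cluster (hl n))).aestronglyMeasurable)
    (integrable_const _) (fun n => .of_forall fun w => f.norm_coe_le_norm _) ?_
  filter_upwards [ae_all_iff.2 h] with w hw
  refine (f.continuous.tendsto w.1).comp (tendsto_subtype_rng.2 (tendsto_pi_nhds.2 fun p => ?_))
  exact tendsto_const_nhds.congr' ((hw p).mono fun n hn => hn.symm)

theorem AIRE_is_weakLimit_of_FIREs {Γ : Type*} [Group Γ] [Countable Γ]
    (ρ : ProbabilityMeasure (EqRelSpace Γ)) (hρ : IsAIRE ρ) :
    ∃ ρs : ℕ → ProbabilityMeasure (EqRelSpace Γ),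
      (∀ n, IsFIRE (ρs n)) ∧ Tendsto ρs atTop (𝓝 ρ) := by
  obtain ⟨hinv, lam, hmeas, hnonneg, htsum, hlim⟩ := hρ
  have hsum (n : ℕ) (r : EqRelSpace Γ) : HasSum (lam n r) 1 := by
    have : Summable (lam n r) := by
      by_contra h
      simpa [tsum_eq_zero_of_not_summable h] using htsum n r
    exact htsum n r ▸ this.hasSum
  obtain ⟨e, he⟩ := exists_injective_nat (Γ × Γ)
  have hchoose (k : ℕ) : ∃ n, ∀ p ∈ {p | e p ≤ k}, ENNReal.ofReal k *
      ∫⁻ r, defect (lam n) p r ∂ρ.toMeasure ≤ ENNReal.ofReal (Real.exp (-k)) := by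
    have hfin : {p | e p ≤ k}.Finite := (Set.finite_Iic k).preimage he.injOn
    refine Eventually.exists (f := atTop) (hfin.eventually_all.2 fun p _ => ?_)
    have h := ENNReal.Tendsto.const_mul (a := ENNReal.ofReal k)
      (tendsto_lintegral_defect hinv hmeas hnonneg hsum hlim p) (.inr ENNReal.ofReal_ne_top)
    rw [mul_zero] at h
    exact h.eventually_le_const (by simp [Real.exp_pos])
  choose N hN using hchoose
  let l (k : ℕ) (r : EqRelSpace Γ) (g : Γ) : ℝ := k * lam (N k) r g
  have hl (k : ℕ) (g : Γ) : Measurable fun r => l k r g := (hmeas (N k) g).const_mul _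
  have hl₀ (k : ℕ) (r : EqRelSpace Γ) (g : Γ) : 0 ≤ l k r g :=
    mul_nonneg k.cast_nonneg (hnonneg _ _ _)
  have hlc (k : ℕ) (r : EqRelSpace Γ) : HasSum (l k r) k := by
    simpa using (hsum (N k) r).mul_left (k : ℝ)
  refine ⟨fun k => clusterLaw ρ (hl k), fun k => isFIRE_clusterLaw hinv (hl k) (hl₀ k) (hlc k),
    tendsto_clusterLaw hl fun p => ?_⟩
  have hbound (k : ℕ) : (ρ.toMeasure.prod (labelLaw Γ))
      {w | e p ≤ k ∧ (cluster (l k) w).1 p ≠ w.1.1 p} ≤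
        2 * ENNReal.ofReal (Real.exp (-k)) := by
    by_cases hk : e p ≤ k
    · simp only [hk, true_and]
      refine (prod_cluster_ne_le (hl k) (hlc k) p).trans ?_
      rw [two_mul]
      gcongr
      simp only [l, defect_smul _ k.cast_nonneg]
      rw [lintegral_const_mul _ (measurable_defect (hmeas _) p)]
      exact hN k p hk
    · simp [hk]
  have hfinite : ∑' k, (ρ.toMeasure.prod (labelLaw Γ))
      {w | e p ≤ k ∧ (cluster (l k) w).1 p ≠ w.1.1 p} ≠ ∞ := by
    refine ne_top_of_le_ne_top ?_ (ENNReal.tsum_le_tsum hbound)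
    rw [ENNReal.tsum_mul_left]
    exact ENNReal.mul_ne_top (by simp) Real.summable_exp_neg_nat.tsum_ofReal_ne_top
  filter_upwards [ae_eventually_notMem hfinite] with w hw
  filter_upwards [hw, eventually_ge_atTop (e p)] with k hk hpk
  by_contra hne
  exact hk ⟨hpk, hne⟩
end

section
/- Let Γ be a countable discrete group and Γ ↷ X a continuous action on a nonempty compact metrizable space. Suppose ρ_n are IREs on Γ converging weakly to an IRE ρ, and for each n, ρ̃_n is a classwise coherent X-marking of ρ_n, such that ρ̃_n converges weakly to a Borel probability measure ρ̃ on E × X^Γ (with X^Γ carrying the product topology). Then ρ̃ is a classwise coherent X-marking of ρ. -/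
open MeasureTheory Filter Topology

variable {Γ : Type*} [Group Γ]

/-- A classwise coherent `Ξ`-marking of an IRE `ρ`, for an action `a : Γ → Ξ → Ξ`:
a `Γ`-invariant Borel probability measure on `E × Ξ^Γ` (for the diagonal action, where
`Γ` acts on `Ξ^Γ` by `(γ·f)(x) = f(γ⁻¹x)`) projecting to `ρ`, such that almost surely
`g·(f(g)) = h·(f(h))` for every pair `(g,h)` in the relation. -/
def IsCCMarking {Γ : Type*} [Group Γ] {Ξ : Type*} [MeasurableSpace Ξ] (a : Γ → Ξ → Ξ)
    (ρ : ProbabilityMeasure (EqRelSpace Γ))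
    (ρ' : ProbabilityMeasure (EqRelSpace Γ × (Γ → Ξ))) : Prop :=
  (∀ γ : Γ, ρ'.toMeasure.map
      (fun p => (shiftE γ p.1, fun x => p.2 (γ⁻¹ * x))) = ρ'.toMeasure) ∧
  ρ'.toMeasure.map Prod.fst = ρ.toMeasure ∧
  ∀ᵐ p ∂ρ'.toMeasure, ∀ g h : Γ, p.1.1 (g, h) = true → a g (p.2 g) = a h (p.2 h)

lemma continuous_shiftE {Γ : Type*} [Group Γ] (γ : Γ) :
    Continuous (shiftE γ : EqRelSpace Γ → EqRelSpace Γ) :=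
  continuous_induced_rng.2
    (continuous_pi fun p =>
      (continuous_apply (γ⁻¹ * p.1, γ⁻¹ * p.2)).comp continuous_subtype_val)

lemma continuous_diagonalShift {Γ : Type*} [Group Γ] {X : Type*} [TopologicalSpace X] (γ : Γ) :
    Continuous fun p : EqRelSpace Γ × (Γ → X) =>
      ((shiftE γ p.1, fun x => p.2 (γ⁻¹ * x)) : EqRelSpace Γ × (Γ → X)) :=
  ((continuous_shiftE γ).comp continuous_fst).prodMk
    (continuous_pi fun _ => (continuous_apply _).comp continuous_snd)

/-- Coherence at a fixed pair of group elements is a closed condition. -/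
lemma isClosed_coherentAt {Γ : Type*} [Group Γ] {X : Type*} [TopologicalSpace X] [T2Space X]
    {a : Γ → X → X} (ha : ∀ γ, Continuous (a γ)) (g h : Γ) :
    IsClosed {p : EqRelSpace Γ × (Γ → X) |
      p.1.1 (g, h) = true → a g (p.2 g) = a h (p.2 h)} := by
  have hev : Continuous fun p : EqRelSpace Γ × (Γ → X) => p.1.1 (g, h) :=
    (continuous_apply _).comp (continuous_subtype_val.comp continuous_fst)
  refine isClosed_imp ((isOpen_discrete {true}).preimage hev) (isClosed_eq ?_ ?_)
  · exact (ha g).comp ((continuous_apply g).comp continuous_snd)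
  · exact (ha h).comp ((continuous_apply h).comp continuous_snd)

/-- A closed condition that holds almost surely along a weakly convergent sequence of probability
measures holds almost surely in the limit. -/
lemma ae_of_tendsto_of_isClosed {Ω : Type*} [TopologicalSpace Ω] [MeasurableSpace Ω]
    [OpensMeasurableSpace Ω] [HasOuterApproxClosed Ω] {μs : ℕ → ProbabilityMeasure Ω}
    {μ : ProbabilityMeasure Ω} (hlim : Tendsto μs atTop (𝓝 μ)) {P : Ω → Prop}
    (hP : IsClosed {ω | P ω}) (h : ∀ n, ∀ᵐ ω ∂(μs n).toMeasure, P ω) :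
    ∀ᵐ ω ∂μ.toMeasure, P ω := by
  have hone : ∀ n, (μs n).toMeasure {ω | P ω} = 1 := fun n =>
    (prob_compl_eq_zero_iff hP.measurableSet).1 (h n)
  have hle := ProbabilityMeasure.limsup_measure_closed_le_of_tendsto hlim hP
  simp only [hone, limsup_const] at hle
  exact (prob_compl_eq_zero_iff hP.measurableSet).2 (le_antisymm prob_le_one hle)

/-- A weak limit of classwise coherent `X`-markings of IREs `ρ_n` weakly converging to `ρ`
(for a continuous action on a nonempty compact metrizable space `X`) is a classwise
coherent `X`-marking of `ρ`. -/
theorem weakLimit_of_CCMarkings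
    {Γ : Type*} [Group Γ] [Countable Γ]
    {X : Type*} [TopologicalSpace X] [CompactSpace X] [TopologicalSpace.MetrizableSpace X]
    [SecondCountableTopology X] [MeasurableSpace X] [BorelSpace X] [Nonempty X]
    (a : Γ → X → X)
    (hone : ∀ x, a 1 x = x) (hmul : ∀ γ δ x, a (γ * δ) x = a γ (a δ x))
    (hcont : ∀ γ, Continuous (a γ))
    (ρs : ℕ → ProbabilityMeasure (EqRelSpace Γ)) (ρ : ProbabilityMeasure (EqRelSpace Γ))
    (hIREs : ∀ n, IsIRE (ρs n)) (hIRE : IsIRE ρ) (hlim : Tendsto ρs atTop (𝓝 ρ))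
    (ρ's : ℕ → ProbabilityMeasure (EqRelSpace Γ × (Γ → X)))
    (hcc : ∀ n, IsCCMarking a (ρs n) (ρ's n))
    (ρ' : ProbabilityMeasure (EqRelSpace Γ × (Γ → X)))
    (hlim' : Tendsto ρ's atTop (𝓝 ρ')) :
    IsCCMarking a ρ ρ' := by
  have hfst : Measurable (Prod.fst : EqRelSpace Γ × (Γ → X) → EqRelSpace Γ) := measurable_fst
  refine ⟨fun γ => ?_, ?_, ?_⟩
  · have hc := continuous_diagonalShift (X := X) γ
    have hmap := ProbabilityMeasure.tendsto_map_of_tendsto_of_continuous ρ's ρ' hlim' hc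
    have heq : ∀ n, (ρ's n).map hc.measurable.aemeasurable = ρ's n := fun n =>
      Subtype.ext ((hcc n).1 γ)
    simp only [heq] at hmap
    exact congrArg ProbabilityMeasure.toMeasure (tendsto_nhds_unique hmap hlim')
  · have hmap := ProbabilityMeasure.tendsto_map_of_tendsto_of_continuous ρ's ρ' hlim'
      continuous_fst
    have heq : ∀ n, (ρ's n).map hfst.aemeasurable = ρs n := fun n => Subtype.ext (hcc n).2.1
    simp only [heq] at hmap
    exact congrArg ProbabilityMeasure.toMeasure (tendsto_nhds_unique hmap hlim)
  · simp only [ae_all_iff (ι := Γ)]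
    exact fun g h => ae_of_tendsto_of_isClosed hlim' (isClosed_coherentAt hcont g h) fun n =>
      (hcc n).2.2.mono fun _ hp => hp g h
end
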